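/- Let d ≥ 1, 0 < α < 1, and let f : ℝ^d → ℝ be locally square-integrable. Suppose there is C₁ < ∞ such that for every z ∈ ℝ^d and R > 0, ∫_0^R ∫_{B_R(z)} ( ν₀^f(x,r) / r^{α−1} )² dx dr/r ≤ C₁ R^d. Then there is a constant C depending only on d and α such that for every z ∈ ℝ^d and R > 0, ∫_0^R ∫_{B_R(z)} ( ν̃₀^f(x,r) / r^{α−1} )² dx dr/r ≤ C C₁ R^d. -/

import Mathlib

open MeasureTheory Metric

/-- `ν₀^f(x,r)`: the best `L²`-approximation of `f` by constants on `B_r(x)`, normalized by `r`. -/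
noncomputable def nu0 (d : ℕ) (f : EuclideanSpace ℝ (Fin d) → ℝ)
    (x : EuclideanSpace ℝ (Fin d)) (r : ℝ) : ℝ :=
  ⨅ c : ℝ, Real.sqrt (⨍ y in ball x r, ((f y - c) / r) ^ 2)

/-- `ν̃₀^f(x,r)`: the normalized `L²` mean of `f(x+y) − f(x)` over the annulus `r/2 ≤ |y| ≤ r`. -/
noncomputable def nu0tilde (d : ℕ) (f : EuclideanSpace ℝ (Fin d) → ℝ)
    (x : EuclideanSpace ℝ (Fin d)) (r : ℝ) : ℝ :=
  Real.sqrt (⨍ y in {y : EuclideanSpace ℝ (Fin d) | r / 2 ≤ ‖y‖ ∧ ‖y‖ ≤ r},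
    ((f (x + y) - f x) / r) ^ 2)

open scoped ENNReal

lemma integral_sub_const_sq {X : Type*} [MeasurableSpace X] {P : Measure X}
    [IsProbabilityMeasure P] {f : X → ℝ} (hf : MemLp f 2 P) (c : ℝ) :
    ∫ y, (f y - c) ^ 2 ∂P
      = (∫ y, (f y) ^ 2 ∂P) - (∫ y, f y ∂P) ^ 2 + ((∫ y, f y ∂P) - c) ^ 2 := by
  have h1 : Integrable f P := hf.integrable (by norm_num)
  have h2 : Integrable (fun y => (f y) ^ 2) P := hf.integrable_sq
  have : (fun y => (f y - c) ^ 2) = fun y => ((f y) ^ 2 - (2 * c) * f y) + c ^ 2 := by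
    ext y; ring
  rw [this, integral_add (f := fun y => (f y) ^ 2 - (2 * c) * f y) (h2.sub (h1.const_mul _))
      (integrable_const _),
    integral_sub h2 (h1.const_mul _), integral_const_mul]
  simp
  ring

lemma setAverage_sub_const_sq {X : Type*} [MeasurableSpace X] {μ : Measure X} {s : Set X}
    (h0 : μ s ≠ 0) (ht : μ s ≠ ∞) {f : X → ℝ} (hf : MemLp f 2 (μ.restrict s)) (c : ℝ) :
    ⨍ y in s, (f y - c) ^ 2 ∂μ
      = (⨍ y in s, (f y) ^ 2 ∂μ) - (⨍ y in s, f y ∂μ) ^ 2 + ((⨍ y in s, f y ∂μ) - c) ^ 2 := by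
  have : IsFiniteMeasure (μ.restrict s) := ⟨by simpa using ht.lt_top⟩
  have : NeZero (μ.restrict s) := ⟨by simpa using h0⟩
  exact integral_sub_const_sq (hf.smul_measure (by simpa using h0)) c

lemma setAverage_le_mul_setAverage {X : Type*} [MeasurableSpace X] {μ : Measure X} {s t : Set X}
    (hst : s ≤ᵐ[μ] t) {K : ℝ} (hs : 0 < μ.real s) (hK : μ.real t ≤ K * μ.real s)
    (ht : 0 < μ.real t) {g : X → ℝ} (hg : ∀ x, 0 ≤ g x) (hgi : IntegrableOn g t μ) :
    ⨍ y in s, g y ∂μ ≤ K * ⨍ y in t, g y ∂μ := by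
  have h := setIntegral_mono_set hgi (Filter.Eventually.of_forall hg) hst
  rw [setAverage_eq, setAverage_eq, smul_eq_mul, smul_eq_mul, ← mul_assoc]
  refine mul_le_mul ?_ h (integral_nonneg hg) ?_
  · rwa [inv_le_iff_one_le_mul₀ hs, mul_right_comm, ← div_eq_mul_inv, one_le_div ht]
  · have : 0 ≤ K := by
      by_contra! h
      nlinarith
    positivity

/-- The mean of `f` over `B_r(x)`. -/
noncomputable def ballMean {d : ℕ} (f : EuclideanSpace ℝ (Fin d) → ℝ)
    (x : EuclideanSpace ℝ (Fin d)) (r : ℝ) : ℝ :=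
  ⨍ y in ball x r, f y

/-- The variance of `f` over `B_r(x)`. -/
noncomputable def ballVar {d : ℕ} (f : EuclideanSpace ℝ (Fin d) → ℝ)
    (x : EuclideanSpace ℝ (Fin d)) (r : ℝ) : ℝ :=
  (⨍ y in ball x r, (f y) ^ 2) - (ballMean f x r) ^ 2

section

variable {d : ℕ} {f : EuclideanSpace ℝ (Fin d) → ℝ}

lemma memLp_two_ball (hm : Measurable f) (hf : LocallyIntegrable (fun x => (f x) ^ 2) volume)
    (x : EuclideanSpace ℝ (Fin d)) (r : ℝ) : MemLp f 2 (volume.restrict (ball x r)) := by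
  rw [memLp_two_iff_integrable_sq hm.aestronglyMeasurable]
  exact (hf.integrableOn_isCompact (isCompact_closedBall x r)).mono_set ball_subset_closedBall

lemma integrableOn_ball_sub_const_sq (hm : Measurable f)
    (hf : LocallyIntegrable (fun x => (f x) ^ 2) volume) (x : EuclideanSpace ℝ (Fin d)) (r c : ℝ) :
    IntegrableOn (fun y => (f y - c) ^ 2) (ball x r) volume := by
  have : IsFiniteMeasure (volume.restrict (ball x r)) := ⟨by simpa using measure_ball_lt_top⟩
  exact ((memLp_two_ball hm hf x r).sub (memLp_const _)).integrable_sq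

lemma volume_real_ball_pos (x : EuclideanSpace ℝ (Fin d)) {r : ℝ} (hr : 0 < r) :
    0 < volume.real (ball x r) :=
  ENNReal.toReal_pos (measure_ball_pos _ _ hr).ne' measure_ball_lt_top.ne

lemma volume_real_ball_half (x : EuclideanSpace ℝ (Fin d)) {r : ℝ} (hr : 0 < r) :
    volume.real (ball x (r / 2)) = volume.real (ball x r) / 2 ^ d := by
  simp only [measureReal_def, Measure.addHaar_ball_of_pos _ _ hr,
    Measure.addHaar_ball_of_pos _ _ (half_pos hr), finrank_euclideanSpace, Fintype.card_fin,
    div_pow, ENNReal.toReal_mul]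
  rw [ENNReal.toReal_ofReal (by positivity), ENNReal.toReal_ofReal (by positivity)]
  ring

lemma ball_ae_eq_closedBall (x : EuclideanSpace ℝ (Fin d)) {r : ℝ} (hr : 0 < r) :
    ball x r =ᵐ[volume] closedBall x r := by
  refine ae_eq_of_subset_of_measure_ge ball_subset_closedBall ?_
    measurableSet_ball.nullMeasurableSet measure_closedBall_lt_top.ne
  rw [Measure.addHaar_closedBall _ _ hr.le, Measure.addHaar_ball_of_pos _ _ hr]

lemma ballVar_add (hm : Measurable f) (hf : LocallyIntegrable (fun x => (f x) ^ 2) volume)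
    (x : EuclideanSpace ℝ (Fin d)) {r : ℝ} (hr : 0 < r) (c : ℝ) :
    ⨍ y in ball x r, (f y - c) ^ 2 = ballVar f x r + (ballMean f x r - c) ^ 2 :=
  setAverage_sub_const_sq (measure_ball_pos _ _ hr).ne' measure_ball_lt_top.ne
    (memLp_two_ball hm hf x r) c

lemma ballVar_nonneg (hm : Measurable f) (hf : LocallyIntegrable (fun x => (f x) ^ 2) volume)
    (x : EuclideanSpace ℝ (Fin d)) {r : ℝ} (hr : 0 < r) : 0 ≤ ballVar f x r := by
  have h := ballVar_add hm hf x hr (ballMean f x r)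
  have h' : 0 ≤ ⨍ y in ball x r, (f y - ballMean f x r) ^ 2 :=
    integral_nonneg fun y => sq_nonneg _
  simpa [h] using h'

lemma nu0_sq (hm : Measurable f) (hf : LocallyIntegrable (fun x => (f x) ^ 2) volume)
    (x : EuclideanSpace ℝ (Fin d)) (r : ℝ) : (nu0 d f x r) ^ 2 = ballVar f x r / r ^ 2 := by
  rcases le_or_gt r 0 with hr | hr
  · simp [nu0, ballVar, ballMean, ball_eq_empty.2 hr]
  have hv := ballVar_nonneg hm hf x hr
  have key (c : ℝ) : ⨍ y in ball x r, ((f y - c) / r) ^ 2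
      = (ballVar f x r + (ballMean f x r - c) ^ 2) / r ^ 2 := by
    rw [← ballVar_add hm hf x hr c]
    simp_rw [div_pow, setAverage_eq, integral_div, smul_eq_mul, mul_div_assoc]
  have : nu0 d f x r = √(ballVar f x r / r ^ 2) := by
    unfold nu0
    simp_rw [key]
    apply le_antisymm
    · refine (ciInf_le ⟨0, ?_⟩ (ballMean f x r)).trans (by simp)
      rintro _ ⟨c, rfl⟩
      positivity
    · refine le_ciInf fun c => Real.sqrt_le_sqrt ?_
      gcongr
      nlinarith [sq_nonneg (ballMean f x r - c)]
  rw [this, Real.sq_sqrt (by positivity)]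

lemma ballMean_half_sub_sq_le (hm : Measurable f)
    (hf : LocallyIntegrable (fun x => (f x) ^ 2) volume)
    (x : EuclideanSpace ℝ (Fin d)) {r : ℝ} (hr : 0 < r) :
    (ballMean f x (r / 2) - ballMean f x r) ^ 2 ≤ 2 ^ d * ballVar f x r := by
  have h1 := ballVar_add hm hf x hr (ballMean f x r)
  have h2 := ballVar_add hm hf x (half_pos hr) (ballMean f x r)
  have h3 := ballVar_nonneg hm hf x (half_pos hr)
  have h4 : ⨍ y in ball x (r / 2), (f y - ballMean f x r) ^ 2
      ≤ 2 ^ d * ⨍ y in ball x r, (f y - ballMean f x r) ^ 2 := by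
    refine setAverage_le_mul_setAverage
      (ball_subset_ball (by linarith)).eventuallyLE (volume_real_ball_pos _ (half_pos hr))
      ?_ (volume_real_ball_pos _ hr) (fun y => sq_nonneg _)
      (integrableOn_ball_sub_const_sq hm hf x r _)
    rw [volume_real_ball_half x hr]
    apply le_of_eq
    field_simp
  rw [h1, h2, sub_self] at h4
  linarith

lemma setAverage_annulus_le (hd : 0 < d) (hm : Measurable f)
    (hf : LocallyIntegrable (fun x => (f x) ^ 2) volume)
    (x : EuclideanSpace ℝ (Fin d)) {r : ℝ} (hr : 0 < r) (c : ℝ) :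
    ⨍ y in {y : EuclideanSpace ℝ (Fin d) | r / 2 ≤ ‖y‖ ∧ ‖y‖ ≤ r}, (f (x + y) - c) ^ 2
      ≤ 4 * ballVar f x r + 4 * (c - ballMean f x r) ^ 2 := by
  have hset : {y : EuclideanSpace ℝ (Fin d) | r / 2 ≤ ‖y‖ ∧ ‖y‖ ≤ r}
      = closedBall 0 r \ ball 0 (r / 2) := by
    ext y; simp [and_comm]
  have hpos := volume_real_ball_pos (0 : EuclideanSpace ℝ (Fin d)) hr
  have hhalf : volume.real (ball (0 : EuclideanSpace ℝ (Fin d)) (r / 2))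
      ≤ volume.real (ball (0 : EuclideanSpace ℝ (Fin d)) r) / 2 := by
    rw [volume_real_ball_half _ hr]
    gcongr
    simpa using pow_le_pow_right₀ (by norm_num : (1 : ℝ) ≤ 2) hd
  have hann : volume.real (closedBall (0 : EuclideanSpace ℝ (Fin d)) r \ ball 0 (r / 2))
      = volume.real (ball (0 : EuclideanSpace ℝ (Fin d)) r)
        - volume.real (ball (0 : EuclideanSpace ℝ (Fin d)) (r / 2)) := by
    rw [measureReal_sdiff ((ball_subset_ball (by linarith)).trans ball_subset_closedBall)
      measurableSet_ball measure_closedBall_lt_top.ne,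
      measureReal_congr (ball_ae_eq_closedBall 0 hr)]
  have hemb : MeasurableEmbedding (fun y : EuclideanSpace ℝ (Fin d) => x + y) :=
    (MeasurableEquiv.addLeft x).measurableEmbedding
  have hmp : MeasurePreserving (fun y : EuclideanSpace ℝ (Fin d) => x + y) volume volume :=
    measurePreserving_add_left volume x
  have hpre : (fun y : EuclideanSpace ℝ (Fin d) => x + y) ⁻¹' (ball x r) = ball 0 r := by
    ext y; simp
  have htr : ⨍ y in ball (0 : EuclideanSpace ℝ (Fin d)) r, (f (x + y) - c) ^ 2
      = ⨍ y in ball x r, (f y - c) ^ 2 := by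
    rw [setAverage_eq, setAverage_eq, ← hpre,
      hmp.setIntegral_preimage_emb hemb (fun y => (f y - c) ^ 2),
      hmp.measureReal_preimage measurableSet_ball.nullMeasurableSet]
  have hle : ⨍ y in {y : EuclideanSpace ℝ (Fin d) | r / 2 ≤ ‖y‖ ∧ ‖y‖ ≤ r}, (f (x + y) - c) ^ 2
      ≤ 2 * ⨍ y in ball (0 : EuclideanSpace ℝ (Fin d)) r, (f (x + y) - c) ^ 2 := by
    rw [hset]
    refine setAverage_le_mul_setAverage
      (Set.sdiff_subset.eventuallyLE.trans (ball_ae_eq_closedBall 0 hr).symm.le)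
      (by rw [hann]; linarith) (by rw [hann]; linarith)
      hpos (fun y => sq_nonneg _) ?_
    rw [← hpre]
    exact (hmp.integrableOn_comp_preimage hemb).2 (integrableOn_ball_sub_const_sq hm hf x r c)
  rw [htr, ballVar_add hm hf x hr] at hle
  nlinarith [ballVar_nonneg hm hf x hr, sq_nonneg (c - ballMean f x r)]

lemma ae_tendsto_ballMean (hm : Measurable f)
    (hf : LocallyIntegrable (fun x => (f x) ^ 2) volume) :
    ∀ᵐ x, Filter.Tendsto (fun r => ballMean f x r) (nhdsWithin 0 (Set.Ioi 0)) (nhds (f x)) := by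
  have hl : LocallyIntegrable f volume := fun x => by
    have : IsFiniteMeasure (volume.restrict (ball x 1)) := ⟨by simpa using measure_ball_lt_top⟩
    exact ⟨ball x 1, ball_mem_nhds x one_pos,
      (memLp_two_ball hm hf x 1).integrable (by norm_num)⟩
  filter_upwards [(Besicovitch.vitaliFamily volume).ae_tendsto_average hl] with x hx
  refine (hx.comp (Besicovitch.tendsto_filterAt volume x)).congr' ?_
  filter_upwards [self_mem_nhdsWithin] with r hr
  exact (setAverage_congr (ball_ae_eq_closedBall x hr)).symm

lemma measurable_setAverage_ball {g : EuclideanSpace ℝ (Fin d) → ℝ} (hg : Measurable g) :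
    Measurable fun p : EuclideanSpace ℝ (Fin d) × ℝ => ⨍ y in ball p.1 p.2, g y := by
  have key {h : EuclideanSpace ℝ (Fin d) → ℝ} (hh : Measurable h) :
      Measurable fun p : EuclideanSpace ℝ (Fin d) × ℝ => ∫ y in ball p.1 p.2, h y := by
    have hs : MeasurableSet {q : (EuclideanSpace ℝ (Fin d) × ℝ) × EuclideanSpace ℝ (Fin d) |
        dist q.2 q.1.1 < q.1.2} := measurableSet_lt (by fun_prop) (by fun_prop)
    have := ((hh.comp measurable_snd).indicator hs).stronglyMeasurable.integral_prod_right'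
      (ν := volume) |>.measurable
    convert this using 2 with p
    rw [← integral_indicator measurableSet_ball]
    rfl
  have h1 := key (h := fun _ => 1) measurable_const
  simp only [setAverage_eq, smul_eq_mul]
  simp at h1
  exact h1.inv.mul (key hg)

lemma measurable_ballVar (hm : Measurable f) :
    Measurable fun p : EuclideanSpace ℝ (Fin d) × ℝ => ballVar f p.1 p.2 :=
  (measurable_setAverage_ball (hm.pow_const 2)).sub ((measurable_setAverage_ball hm).pow_const 2)

end

/-- Quantitative telescoping: Cauchy–Schwarz against the weights `q ^ n`. -/
lemma ofReal_sub_sq_le_tsum {u D : ℕ → ℝ} {L q : ℝ} (hq0 : 0 < q) (hq1 : q < 1)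
    (hu : Filter.Tendsto u Filter.atTop (nhds L)) (hD : ∀ n, (u (n + 1) - u n) ^ 2 ≤ D n) :
    ENNReal.ofReal ((L - u 0) ^ 2)
      ≤ ENNReal.ofReal (1 - q)⁻¹ * ∑' n, ENNReal.ofReal (D n / q ^ n) := by
  have hD0 (n : ℕ) : 0 ≤ D n / q ^ n := div_nonneg ((sq_nonneg _).trans (hD n)) (by positivity)
  have hlim : Filter.Tendsto (fun n => ENNReal.ofReal ((u n - u 0) ^ 2)) Filter.atTop
      (nhds (ENNReal.ofReal ((L - u 0) ^ 2))) :=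
    ENNReal.tendsto_ofReal ((hu.sub_const _).pow 2)
  refine le_of_tendsto' hlim fun N => ?_
  have hcs : (u N - u 0) ^ 2
      ≤ (∑ n ∈ Finset.range N, q ^ n) * ∑ n ∈ Finset.range N, D n / q ^ n := by
    rw [← Finset.sum_range_sub]
    refine Finset.sum_sq_le_sum_mul_sum_of_sq_le_mul _ (fun n _ => by positivity)
      (fun n _ => hD0 n) fun n _ => ?_
    rw [mul_div_cancel₀ _ (by positivity)]
    exact hD n
  have hgeom : ∑ n ∈ Finset.range N, q ^ n ≤ (1 - q)⁻¹ := by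
    rw [← tsum_geometric_of_lt_one hq0.le hq1]
    exact (summable_geometric_of_lt_one hq0.le hq1).sum_le_tsum _ fun n _ => by positivity
  calc ENNReal.ofReal ((u N - u 0) ^ 2)
      ≤ ENNReal.ofReal ((1 - q)⁻¹ * ∑ n ∈ Finset.range N, D n / q ^ n) :=
        ENNReal.ofReal_le_ofReal (hcs.trans
          (mul_le_mul_of_nonneg_right hgeom (Finset.sum_nonneg fun n _ => hD0 n)))
    _ ≤ _ := by
        rw [ENNReal.ofReal_mul (by rw [inv_nonneg]; linarith),
          ENNReal.ofReal_sum_of_nonneg fun n _ => hD0 n]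
        gcongr
        exact ENNReal.sum_le_tsum _

lemma setLIntegral_comp_div_le {Φ : ℝ → ℝ≥0∞} (hΦ : Measurable Φ) {a : ℝ} (ha : 1 ≤ a) (R : ℝ) :
    ∫⁻ r in Set.Ioo 0 R, Φ (r / a) / ENNReal.ofReal r
      ≤ ∫⁻ r in Set.Ioo 0 R, Φ r / ENNReal.ofReal r := by
  have ha0 : 0 < a := by linarith
  set G : ℝ → ℝ≥0∞ := (Set.Ioo 0 R).indicator fun r => Φ r / ENNReal.ofReal r with hG
  have hGm : Measurable G := (hΦ.div (by fun_prop)).indicator measurableSet_Ioo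
  have hmap : Measure.map (a⁻¹ * ·) volume = ENNReal.ofReal a • (volume : Measure ℝ) := by
    rw [Real.map_volume_mul_left (by positivity), inv_inv, abs_of_pos ha0]
  calc ∫⁻ r in Set.Ioo 0 R, Φ (r / a) / ENNReal.ofReal r
      ≤ ∫⁻ r in Set.Ioo 0 R, (ENNReal.ofReal a)⁻¹ * G (a⁻¹ * r) := by
        refine setLIntegral_mono' measurableSet_Ioo fun r hr => le_of_eq ?_
        have h1 : a⁻¹ * r = r / a := by ring
        have h2 : r / a ∈ Set.Ioo 0 R :=
          ⟨div_pos hr.1 ha0, (div_le_self hr.1.le ha).trans_lt hr.2⟩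
        have h3 : ENNReal.ofReal r = ENNReal.ofReal a * ENNReal.ofReal (r / a) := by
          rw [← ENNReal.ofReal_mul ha0.le, mul_div_cancel₀ _ ha0.ne']
        simp only [h1, hG, Set.indicator_of_mem h2]
        rw [h3, div_eq_mul_inv (Φ _), div_eq_mul_inv (Φ _),
          ENNReal.mul_inv (by simp [ha0]) (by simp), mul_left_comm]
    _ ≤ ∫⁻ r, (ENNReal.ofReal a)⁻¹ * G (a⁻¹ * r) := setLIntegral_le_lintegral _ _
    _ = (ENNReal.ofReal a)⁻¹ * ∫⁻ r, G r ∂(Measure.map (a⁻¹ * ·) volume) := by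
        rw [lintegral_map hGm (by fun_prop), lintegral_const_mul _ (by fun_prop)]
    _ = ∫⁻ r, G r := by
        rw [hmap, lintegral_smul_measure, smul_eq_mul, ← mul_assoc,
          ENNReal.inv_mul_cancel (by simp [ha0]) (by simp), one_mul]
    _ = ∫⁻ r in Set.Ioo 0 R, Φ r / ENNReal.ofReal r := lintegral_indicator measurableSet_Ioo _

lemma setLIntegral_le_of_ae_le_tsum {X : Type*} [MeasurableSpace X] {μ : Measure X} [SFinite μ]
    {F H : X → ℝ → ℝ≥0∞} (hH : Measurable fun p : X × ℝ => H p.1 p.2) {K B : ℝ≥0∞}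
    {c : ℕ → ℝ≥0∞} {R : ℝ}
    (hF : ∀ r, 0 < r → ∀ᵐ x ∂μ, F x r ≤ K * ∑' k : ℕ, c k * H x (r / 2 ^ k))
    (hB : ∫⁻ r in Set.Ioo 0 R, (∫⁻ x, H x r ∂μ) / ENNReal.ofReal r ≤ B) :
    ∫⁻ r in Set.Ioo 0 R, (∫⁻ x, F x r ∂μ) / ENNReal.ofReal r ≤ K * ((∑' k, c k) * B) := by
  have hHx (s : ℝ) : Measurable fun x => H x s := hH.comp measurable_prodMk_right
  set Φ : ℝ → ℝ≥0∞ := fun r => ∫⁻ x, H x r ∂μ with hΦ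
  have hΦm : Measurable Φ := hH.lintegral_prod_left'
  have hΦk (k : ℕ) : Measurable fun r : ℝ => Φ (r / 2 ^ k) / ENNReal.ofReal r :=
    (hΦm.comp (by fun_prop)).div (by fun_prop)
  calc ∫⁻ r in Set.Ioo 0 R, (∫⁻ x, F x r ∂μ) / ENNReal.ofReal r
      ≤ ∫⁻ r in Set.Ioo 0 R, K * ∑' k : ℕ, c k * (Φ (r / 2 ^ k) / ENNReal.ofReal r) := by
        refine setLIntegral_mono' measurableSet_Ioo fun r hr => ?_
        have hle := lintegral_mono_ae (hF r hr.1)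
        rw [lintegral_const_mul _ (Measurable.tsum fun k => (hHx _).const_mul _),
          lintegral_tsum fun k => ((hHx _).const_mul _).aemeasurable] at hle
        simp_rw [lintegral_const_mul _ (hHx _)] at hle
        simp_rw [div_eq_mul_inv _ (ENNReal.ofReal r), ← mul_assoc, ENNReal.tsum_mul_right,
          ← mul_assoc]
        gcongr
    _ = K * ∑' k : ℕ, c k * ∫⁻ r in Set.Ioo 0 R, Φ (r / 2 ^ k) / ENNReal.ofReal r := by
        rw [lintegral_const_mul _ (Measurable.tsum fun k => (hΦk k).const_mul _),
          lintegral_tsum fun k => ((hΦk k).const_mul _).aemeasurable]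
        simp_rw [lintegral_const_mul _ (hΦk _)]
    _ ≤ K * ∑' k : ℕ, c k * B := by
        gcongr with k
        exact (setLIntegral_comp_div_le hΦm (one_le_pow₀ (by norm_num)) R).trans hB
    _ = K * ((∑' k, c k) * B) := by rw [ENNReal.tsum_mul_right]

section

variable {d : ℕ} {f : EuclideanSpace ℝ (Fin d) → ℝ}

lemma ofReal_nu0tilde_sq_le_tsum (hd : 0 < d) (hm : Measurable f)
    (hf : LocallyIntegrable (fun x => (f x) ^ 2) volume) {α : ℝ} (hα : 0 < α)
    {x : EuclideanSpace ℝ (Fin d)}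
    (hx : Filter.Tendsto (fun r => ballMean f x r) (nhdsWithin 0 (Set.Ioi 0)) (nhds (f x)))
    {r : ℝ} (hr : 0 < r) :
    ENNReal.ofReal ((nu0tilde d f x r / r ^ (α - 1)) ^ 2)
      ≤ ENNReal.ofReal (4 + 4 * 2 ^ d * (1 - (2 : ℝ) ^ (-α))⁻¹)
        * ∑' k : ℕ, ENNReal.ofReal (((2 : ℝ) ^ (-α)) ^ k)
          * ENNReal.ofReal ((nu0 d f x (r / 2 ^ k) / (r / 2 ^ k) ^ (α - 1)) ^ 2) := by
  set q : ℝ := (2 : ℝ) ^ (-α) with hq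
  have hq0 : 0 < q := by positivity
  have hq1 : q < 1 := Real.rpow_lt_one_of_one_lt_of_neg (by norm_num) (by linarith)
  have hq1' : 0 < 1 - q := by linarith
  set T : ℝ≥0∞ := ∑' k : ℕ, ENNReal.ofReal (ballVar f x (r / 2 ^ k) / q ^ k) with hT
  set w : ℝ := (r ^ α) ^ 2 with hw
  have hw0 : 0 < w := by positivity
  have hweight {s : ℝ} (hs : 0 < s) : s ^ 2 * (s ^ (α - 1)) ^ 2 = (s ^ α) ^ 2 := by
    rw [Real.rpow_sub_one hs.ne']
    field_simp
  have hterm (k : ℕ) : ENNReal.ofReal (q ^ k)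
      * ENNReal.ofReal ((nu0 d f x (r / 2 ^ k) / (r / 2 ^ k) ^ (α - 1)) ^ 2)
      = ENNReal.ofReal w⁻¹ * ENNReal.ofReal (ballVar f x (r / 2 ^ k) / q ^ k) := by
    have hs : 0 < r / 2 ^ k := by positivity
    have hpow : (r / 2 ^ k) ^ α = r ^ α * q ^ k := by
      rw [Real.div_rpow hr.le (by positivity), hq, Real.rpow_neg (by norm_num), inv_pow,
        ← Real.rpow_natCast, ← Real.rpow_natCast, ← Real.rpow_mul (by norm_num),
        ← Real.rpow_mul (by norm_num), mul_comm α, div_eq_mul_inv]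
    rw [← ENNReal.ofReal_mul (by positivity), ← ENNReal.ofReal_mul (by positivity), div_pow,
      nu0_sq hm hf, div_div, hweight hs, hpow, hw]
    congr 1
    field_simp
  have hlim : Filter.Tendsto (fun k : ℕ => ballMean f x (r / 2 ^ k)) Filter.atTop
      (nhds (f x)) := by
    refine hx.comp (tendsto_nhdsWithin_iff.2 ⟨?_, Filter.Eventually.of_forall fun k => ?_⟩)
    · have := (tendsto_pow_atTop_nhds_zero_of_lt_one (r := (1 / 2 : ℝ)) (by norm_num)
        (by norm_num)).const_mul r
      simpa [div_eq_mul_inv] using this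
    · exact Set.mem_Ioi.2 (by positivity)
  have htel := ofReal_sub_sq_le_tsum hq0 hq1 hlim
    (D := fun k => 2 ^ d * ballVar f x (r / 2 ^ k)) fun k => by
      have := ballMean_half_sub_sq_le hm hf x (r := r / 2 ^ k) (by positivity)
      rwa [div_div, ← pow_succ] at this
  simp_rw [mul_div_assoc, ENNReal.ofReal_mul (show (0 : ℝ) ≤ 2 ^ d by positivity)] at htel
  rw [ENNReal.tsum_mul_left, pow_zero, div_one, ← hT] at htel
  have hT0 : ENNReal.ofReal (ballVar f x r) ≤ T := by
    simpa using
      ENNReal.le_tsum (f := fun k : ℕ => ENNReal.ofReal (ballVar f x (r / 2 ^ k) / q ^ k)) 0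
  have hsq : (nu0tilde d f x r / r ^ (α - 1)) ^ 2
      ≤ w⁻¹ * (4 * ballVar f x r + 4 * (f x - ballMean f x r) ^ 2) := by
    rw [div_pow, nu0tilde, Real.sq_sqrt (by exact integral_nonneg fun y => sq_nonneg _)]
    have : ⨍ y in {y : EuclideanSpace ℝ (Fin d) | r / 2 ≤ ‖y‖ ∧ ‖y‖ ≤ r},
        ((f (x + y) - f x) / r) ^ 2
        = (⨍ y in {y : EuclideanSpace ℝ (Fin d) | r / 2 ≤ ‖y‖ ∧ ‖y‖ ≤ r},
          (f (x + y) - f x) ^ 2) / r ^ 2 := by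
      simp_rw [div_pow, setAverage_eq, integral_div, smul_eq_mul, mul_div_assoc]
    rw [this, div_div, hweight hr, ← hw, div_eq_inv_mul]
    gcongr
    exact setAverage_annulus_le hd hm hf x hr (f x)
  have hV0 : 0 ≤ ballVar f x r := ballVar_nonneg hm hf x hr
  simp_rw [hterm, ENNReal.tsum_mul_left, ← hT]
  calc ENNReal.ofReal ((nu0tilde d f x r / r ^ (α - 1)) ^ 2)
      ≤ ENNReal.ofReal w⁻¹ * (ENNReal.ofReal 4 * ENNReal.ofReal (ballVar f x r)
          + ENNReal.ofReal 4 * ENNReal.ofReal ((f x - ballMean f x r) ^ 2)) := by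
        rw [← ENNReal.ofReal_mul (by norm_num), ← ENNReal.ofReal_mul (by norm_num),
          ← ENNReal.ofReal_add (by positivity) (by positivity),
          ← ENNReal.ofReal_mul (by positivity)]
        exact ENNReal.ofReal_le_ofReal hsq
    _ ≤ ENNReal.ofReal w⁻¹ * (ENNReal.ofReal 4 * T
          + ENNReal.ofReal 4 * (ENNReal.ofReal (1 - q)⁻¹ * (ENNReal.ofReal (2 ^ d) * T))) := by
        gcongr
    _ = _ := by
        rw [ENNReal.ofReal_add (by norm_num) (by positivity), ENNReal.ofReal_mul (by positivity),
          ENNReal.ofReal_mul (by positivity)]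
        ring

lemma measurable_ofReal_nu0_sq (hm : Measurable f)
    (hf : LocallyIntegrable (fun x => (f x) ^ 2) volume) (α : ℝ) :
    Measurable fun p : EuclideanSpace ℝ (Fin d) × ℝ =>
      ENNReal.ofReal ((nu0 d f p.1 p.2 / p.2 ^ (α - 1)) ^ 2) := by
  simp_rw [div_pow, nu0_sq hm hf]
  have := measurable_ballVar hm
  fun_prop

end

/-- For `0 < α < 1`, the square function bound for `ν₀` implies the square
function bound for `ν̃₀`, with constant multiplied by a factor depending only on `d` and `α`. -/
theorem nu0_square_function_implies_nu0tilde (d : ℕ) (hd : 0 < d)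
    (α : ℝ) (hα0 : 0 < α) (hα1 : α < 1) :
    ∃ C : ℝ, 0 < C ∧
      ∀ (f : EuclideanSpace ℝ (Fin d) → ℝ) (C₁ : ℝ), Measurable f →
        LocallyIntegrable (fun x => (f x) ^ 2) volume → 0 ≤ C₁ →
        (∀ (z : EuclideanSpace ℝ (Fin d)) (R : ℝ), 0 < R →
          (∫⁻ r in Set.Ioo (0 : ℝ) R,
            (∫⁻ x in ball z R,
              ENNReal.ofReal ((nu0 d f x r / r ^ (α - 1)) ^ 2)) / ENNReal.ofReal r)
            ≤ ENNReal.ofReal (C₁ * R ^ (d : ℕ))) →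
        ∀ (z : EuclideanSpace ℝ (Fin d)) (R : ℝ), 0 < R →
          (∫⁻ r in Set.Ioo (0 : ℝ) R,
            (∫⁻ x in ball z R,
              ENNReal.ofReal ((nu0tilde d f x r / r ^ (α - 1)) ^ 2)) / ENNReal.ofReal r)
            ≤ ENNReal.ofReal (C * C₁ * R ^ (d : ℕ)) := by
  have hq0 : (0 : ℝ) < (2 : ℝ) ^ (-α) := by positivity
  have hq1 : (2 : ℝ) ^ (-α) < 1 :=
    Real.rpow_lt_one_of_one_lt_of_neg (by norm_num) (by linarith)
  have hq1' : 0 < 1 - (2 : ℝ) ^ (-α) := by linarith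
  refine ⟨(4 + 4 * 2 ^ d * (1 - (2 : ℝ) ^ (-α))⁻¹) * (1 - (2 : ℝ) ^ (-α))⁻¹, by positivity,
    fun f C₁ hm hf hC₁ h z R hR => ?_⟩
  refine (setLIntegral_le_of_ae_le_tsum (measurable_ofReal_nu0_sq hm hf α)
    (K := ENNReal.ofReal (4 + 4 * 2 ^ d * (1 - (2 : ℝ) ^ (-α))⁻¹))
    (c := fun k => ENNReal.ofReal (((2 : ℝ) ^ (-α)) ^ k)) (fun r hr => ?_)
    (h z R hR)).trans_eq ?_
  · refine ae_restrict_of_ae ?_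
    filter_upwards [ae_tendsto_ballMean hm hf] with x hx
    exact ofReal_nu0tilde_sq_le_tsum hd hm hf hα0 hx hr
  · rw [← ENNReal.ofReal_tsum_of_nonneg (fun k => by positivity)
        (summable_geometric_of_lt_one hq0.le hq1), tsum_geometric_of_lt_one hq0.le hq1,
      ← ENNReal.ofReal_mul (by positivity), ← ENNReal.ofReal_mul (by positivity)]
    congr 1
    ring
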